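/- arXiv:2505.05213 — 2 statements merged into one kernel-verified Lean document; each statement's English description precedes it below -/
import Mathlib

section
/- Let G be a graph whose critical independent set quotient graph has more than 6k nodes, such that no node of the quotient graph is isolated or contained in a component consisting of a single edge. Then G cannot be transformed into a bicluster graph by at most k operations, where each operation adds an edge, removes an edge, or splits a vertex. -/
def IsCompleteBipartiteOn {V : Type*} (G : SimpleGraph V) (s : Set V) : Prop :=
  ∃ A B : Set V, A ∪ B = s ∧ Disjoint A B ∧
    ∀ u ∈ s, ∀ v ∈ s, (G.Adj u v ↔ (u ∈ A ∧ v ∈ B) ∨ (u ∈ B ∧ v ∈ A))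

/-- A bicluster graph: every connected component is a complete bipartite graph. -/
def IsBicluster {V : Type*} (G : SimpleGraph V) : Prop :=
  ∀ c : G.ConnectedComponent, IsCompleteBipartiteOn G c.supp

/-- The graph obtained from `G` by splitting the vertex `v` into two copies:
`Sum.inl v` (with neighborhood `N1`) and `Sum.inr ()` (with neighborhood `N2`);
all other vertices `Sum.inl a` keep their adjacencies. -/
def splitGraph {V : Type} (G : SimpleGraph V) (v : V) (N1 N2 : Set V) :
    SimpleGraph (V ⊕ Unit) :=
  SimpleGraph.fromRel (fun x y =>
    match x, y with
    | Sum.inl a, Sum.inl b => (a = v ∧ b ∈ N1) ∨ (a ≠ v ∧ b ≠ v ∧ G.Adj a b)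
    | Sum.inl a, Sum.inr _ => a ∈ N2
    | Sum.inr _, _ => False)

/-- One edit operation: adding an edge, deleting an edge, or splitting a vertex
(the two copies must have neighborhoods whose union is the original neighborhood). -/
inductive EditStep : {V : Type} → SimpleGraph V → {W : Type} → SimpleGraph W → Prop where
  | add {V : Type} (G : SimpleGraph V) (u v : V) (h : u ≠ v) :
      EditStep G (G ⊔ SimpleGraph.fromEdgeSet {s(u, v)})
  | del {V : Type} (G : SimpleGraph V) (u v : V) :
      EditStep G (G \ SimpleGraph.fromEdgeSet {s(u, v)})
  | split {V : Type} (G : SimpleGraph V) (v : V) (N1 N2 : Set V)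
      (h : N1 ∪ N2 = G.neighborSet v) :
      EditStep G (splitGraph G v N1 N2)

/-- `EditSeq n G H`: the graph `H` is obtained from `G` by a sequence of `n` edit
operations. -/
inductive EditSeq : ℕ → {V : Type} → SimpleGraph V → {W : Type} → SimpleGraph W → Prop where
  | nil {V : Type} (G : SimpleGraph V) : EditSeq 0 G G
  | cons {n : ℕ} {V W X : Type} {G : SimpleGraph V} {H : SimpleGraph W} {K : SimpleGraph X} :
      EditStep G H → EditSeq n H K → EditSeq (n + 1) G K

/-- The setoid of the false-twin relation (equal open neighborhoods). -/
def nbhdSetoid {V : Type} (G : SimpleGraph V) : Setoid V :=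
  ⟨fun u v => G.neighborSet u = G.neighborSet v, ⟨fun _ => rfl, Eq.symm, Eq.trans⟩⟩

/-- The critical independent set quotient graph of `G`: one node per critical
independent set (class of false twins), two nodes adjacent iff some (equivalently,
every) pair of representatives is adjacent. -/
def quotGraph {V : Type} (G : SimpleGraph V) : SimpleGraph (Quotient (nbhdSetoid G)) :=
  SimpleGraph.fromRel (fun c d => ∃ u v : V,
    Quotient.mk (nbhdSetoid G) u = c ∧ Quotient.mk (nbhdSetoid G) v = d ∧ G.Adj u v)

/-- `f` sends each vertex of `H` to its ancestor in `G`; `M` is the set of touched vertices. -/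
def Trace (n : ℕ) {V : Type} (G : SimpleGraph V) {W : Type} (H : SimpleGraph W) : Prop :=
  ∃ (f : W → V) (M : Finset W), M.card ≤ 2 * n ∧ Function.Surjective f ∧
    (∀ x y, x ∉ M → y ∉ M → f x = f y → x = y) ∧
    ∀ x, x ∉ M → ∀ b, G.Adj (f x) b ↔ ∃ y, H.Adj x y ∧ f y = b

lemma trace_step {V : Type} {G : SimpleGraph V} {W : Type} {H : SimpleGraph W}
    (h : EditStep G H) : Trace 1 G H := by
  classical
  cases h with
  | add u v h =>
    refine ⟨id, {u, v}, Finset.card_le_two, Function.surjective_id, fun x y _ _ h => h, ?_⟩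
    intro x hx b
    simp only [Finset.mem_insert, Finset.mem_singleton, not_or] at hx
    simp [hx.1, hx.2]
  | del u v =>
    refine ⟨id, {u, v}, Finset.card_le_two, Function.surjective_id, fun x y _ _ h => h, ?_⟩
    intro x hx b
    simp only [Finset.mem_insert, Finset.mem_singleton, not_or] at hx
    simp [hx.1, hx.2]
  | split v N1 N2 h =>
    refine ⟨Sum.elim id (fun _ => v), {Sum.inl v, Sum.inr ()}, Finset.card_le_two,
      fun x => ⟨Sum.inl x, rfl⟩, ?_, ?_⟩
    · rintro (x | x) (y | y) hx hy h <;> simp_all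
    · rintro (x | x) hx b
      · have hxv : x ≠ v := by simpa using hx
        have hN : G.Adj v x ↔ x ∈ N1 ∨ x ∈ N2 := by
          rw [← Set.mem_union, h, SimpleGraph.mem_neighborSet]
        have hxx : b = x → ¬ G.Adj x b := by rintro rfl; simp
        simp only [Sum.elim_inl, id, Sum.exists, splitGraph, SimpleGraph.fromRel_adj]
        constructor
        · intro hb
          by_cases hbv : b = v
          · subst hbv
            rcases hN.1 hb.symm with h1 | h2
            · exact Or.inl ⟨b, ⟨by simpa using hxv, Or.inr (Or.inl ⟨rfl, h1⟩)⟩, rfl⟩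
            · exact Or.inr ⟨(), ⟨by simp, Or.inl h2⟩, rfl⟩
          · exact Or.inl ⟨b, ⟨by simpa using hb.ne, Or.inl (Or.inr ⟨hxv, hbv, hb⟩)⟩, rfl⟩
        · rintro (⟨y, ⟨-, hy⟩, rfl⟩ | ⟨y, ⟨-, hy⟩, rfl⟩)
          · rcases hy with (⟨h1, -⟩ | ⟨-, -, h1⟩) | (⟨rfl, h1⟩ | ⟨-, -, h1⟩)
            · exact absurd h1 hxv
            · exact h1
            · exact (hN.2 (Or.inl h1)).symm
            · exact h1.symm
          · rcases hy with hy | hy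
            · exact (hN.2 (Or.inr hy)).symm
            · exact hy.elim
      · simp at hx

lemma trace_seq {n : ℕ} {V : Type} {G : SimpleGraph V} {W : Type} {H : SimpleGraph W}
    (h : EditSeq n G H) : Trace n G H := by
  classical
  induction h with
  | nil G => exact ⟨id, ∅, by simp, Function.surjective_id, fun x y _ _ h => h, by simp⟩
  | @cons n V W X G H K h _ ih =>
    obtain ⟨f1, M1, c1, s1, i1, a1⟩ := trace_step h
    obtain ⟨f2, M2, c2, s2, i2, a2⟩ := ih
    -- unmarked preimages of marked vertices
    have hinj : Set.InjOn f2 {x | x ∉ M2} := fun x hx y hy h => i2 x y hx hy h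
    have hfin : Set.Finite {x | x ∉ M2 ∧ f2 x ∈ M1} :=
      Set.Finite.of_finite_image (f := f2)
        (M1.finite_toSet.subset (by rintro _ ⟨x, hx, rfl⟩; exact hx.2))
        (hinj.mono fun x hx => hx.1)
    have hc : hfin.toFinset.card ≤ M1.card := by
      apply Finset.card_le_card_of_injOn f2
      · intro x hx
        simp at hx
        exact hx.2
      · exact hinj.mono (by intro x hx; simp at hx; exact hx.1)
    refine ⟨f1 ∘ f2, M2 ∪ hfin.toFinset, ?_, s1.comp s2, ?_, ?_⟩
    · have := Finset.card_union_le M2 hfin.toFinset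
      omega
    · intro x y hx hy hxy
      simp at hx hy
      exact i2 x y hx.1 hy.1 (i1 _ _ (hx.2 hx.1) (hy.2 hy.1) hxy)
    · intro x hx b
      simp at hx
      rw [Function.comp, a1 _ (hx.2 hx.1)]
      constructor
      · rintro ⟨y, hy, rfl⟩
        obtain ⟨z, hz, rfl⟩ := (a2 x hx.1 y).1 hy
        exact ⟨z, hz, rfl⟩
      · rintro ⟨z, hz, rfl⟩
        exact ⟨f2 z, (a2 x hx.1 _).2 ⟨z, hz, rfl⟩, rfl⟩

lemma bicluster_side {W : Type} {H : SimpleGraph W} (h : IsBicluster H) :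
    ∃ s : W → Prop, ∀ u v, H.Adj u v ↔ H.Reachable u v ∧ (s u ↔ ¬ s v) := by
  choose A B hU hD hA using h
  refine ⟨fun u => u ∈ A (H.connectedComponentMk u), fun u v => ?_⟩
  have key : H.Reachable u v →
      (H.Adj u v ↔ (u ∈ A (H.connectedComponentMk u) ↔ v ∉ A (H.connectedComponentMk v))) := by
    intro r
    have e : H.connectedComponentMk v = H.connectedComponentMk u :=
      (SimpleGraph.ConnectedComponent.eq.2 r).symm
    rw [e]
    have hu : u ∈ (H.connectedComponentMk u).supp := rfl
    generalize H.connectedComponentMk u = c at e hu ⊢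
    have hv : v ∈ c.supp := e
    rw [hA c u hu v hv]
    rw [← hU c] at hu hv
    have d1 : u ∈ A c → u ∉ B c := fun h => Set.disjoint_left.1 (hD c) h
    have d2 : v ∈ A c → v ∉ B c := fun h => Set.disjoint_left.1 (hD c) h
    simp only [Set.mem_union] at hu hv
    tauto
  constructor
  · intro hadj
    exact ⟨hadj.reachable, (key hadj.reachable).1 hadj⟩
  · rintro ⟨r, hs⟩
    exact (key r).2 hs

lemma quot_adj {V : Type} {G : SimpleGraph V} (u : V) (e : Quotient (nbhdSetoid G)) :
    (quotGraph G).Adj (Quotient.mk _ u) e ↔ ∃ y, Quotient.mk _ y = e ∧ G.Adj u y := by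
  have tw : ∀ {a b : V}, Quotient.mk (nbhdSetoid G) a = Quotient.mk (nbhdSetoid G) b →
      ∀ z, G.Adj a z ↔ G.Adj b z := by
    intro a b h z
    have h' : G.neighborSet a = G.neighborSet b := Quotient.exact h
    rw [← SimpleGraph.mem_neighborSet, h', SimpleGraph.mem_neighborSet]
  rw [quotGraph, SimpleGraph.fromRel_adj]
  constructor
  · rintro ⟨-, ⟨a, b, ha, hb, hab⟩ | ⟨a, b, ha, hb, hab⟩⟩
    · exact ⟨b, hb, (tw ha b).1 hab⟩
    · exact ⟨a, ha, (tw hb a).1 hab.symm⟩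
  · rintro ⟨y, rfl, hy⟩
    refine ⟨fun h => ?_, Or.inl ⟨u, y, rfl, rfl, hy⟩⟩
    exact G.irrefl ((tw h y).1 hy)

/-- If the critical independent set quotient graph of `G` has more than `6k` nodes,
no isolated node, and no component that is a single edge, then `G` cannot be
transformed into a bicluster graph by at most `k` edit operations. -/
theorem stmt_12 {V : Type} [Finite V] (G : SimpleGraph V) (k : ℕ)
    (hcard : 6 * k < Nat.card (Quotient (nbhdSetoid G)))
    (hiso : ∀ c : Quotient (nbhdSetoid G), ∃ d, (quotGraph G).Adj c d)
    (hK2 : ∀ c d : Quotient (nbhdSetoid G), (quotGraph G).Adj c d →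
      (∃ e, e ≠ d ∧ (quotGraph G).Adj c e) ∨ (∃ e, e ≠ c ∧ (quotGraph G).Adj d e)) :
    ¬ ∃ (n : ℕ) (W : Type) (H : SimpleGraph W), n ≤ k ∧ EditSeq n G H ∧ IsBicluster H := by
  classical
  rintro ⟨n, W, H, hn, hseq, hbi⟩
  obtain ⟨f, M, hM, fs, -, fa⟩ := trace_seq hseq
  obtain ⟨s, hs⟩ := bicluster_side hbi
  -- unmarked vertices in the same component and on the same side are twins
  have twin : ∀ x y, x ∉ M → y ∉ M → H.Reachable x y → (s x ↔ s y) →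
      Quotient.mk (nbhdSetoid G) (f x) = Quotient.mk (nbhdSetoid G) (f y) := by
    intro x y hx hy r hxy
    apply Quotient.sound
    change G.neighborSet (f x) = G.neighborSet (f y)
    ext b
    rw [SimpleGraph.mem_neighborSet, SimpleGraph.mem_neighborSet, fa x hx, fa y hy]
    have : ∀ z, H.Adj x z ↔ H.Adj y z := by
      intro z
      rw [hs, hs, hxy]
      exact and_congr_left fun _ => ⟨fun h => r.symm.trans h, fun h => r.trans h⟩
    simp [this]
  -- every component has a marked vertex
  have marked : ∀ x, ∃ m ∈ M, H.Reachable x m := by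
    intro x
    by_contra! hno
    have hun : ∀ y, H.Reachable x y → y ∉ M := fun y r hy => hno y hy r
    have huniq : ∀ a b, H.Reachable x a → H.Adj a b → ∀ e,
        (quotGraph G).Adj (Quotient.mk _ (f a)) e → e = Quotient.mk _ (f b) := by
      intro a b ra hab e he
      obtain ⟨y, rfl, hy⟩ := (quot_adj _ _).1 he
      obtain ⟨z, hz, rfl⟩ := (fa a (hun a ra) y).1 hy
      refine twin z b (hun z (ra.trans hz.reachable)) (hun b (ra.trans hab.reachable))
        (hz.reachable.symm.trans hab.reachable) ?_
      have h1 := ((hs a z).1 hz).2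
      have h2 := ((hs a b).1 hab).2
      tauto
    obtain ⟨d, hd⟩ := hiso (Quotient.mk _ (f x))
    obtain ⟨y, rfl, hy⟩ := (quot_adj _ _).1 hd
    obtain ⟨z, hz, rfl⟩ := (fa x (hun x (SimpleGraph.Reachable.refl x)) y).1 hy
    rcases hK2 _ _ hd with ⟨e, hne, he⟩ | ⟨e, hne, he⟩
    · exact hne (huniq x z (SimpleGraph.Reachable.refl x) hz e he)
    · exact hne (huniq z x hz.reachable hz.symm e he)
  choose m hmM hmr using marked
  have hrep : ∀ c : Quotient (nbhdSetoid G), ∃ w, Quotient.mk _ (f w) = c := by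
    intro c
    obtain ⟨v, rfl⟩ := Quotient.exists_rep c
    obtain ⟨w, rfl⟩ := fs v
    exact ⟨w, rfl⟩
  choose r hr using hrep
  let g : Quotient (nbhdSetoid G) → M ⊕ (M × Bool) := fun c =>
    if h : r c ∈ M then Sum.inl ⟨r c, h⟩ else Sum.inr (⟨m (r c), hmM _⟩, decide (s (r c)))
  have ginj : Function.Injective g := by
    intro c d hcd
    by_cases hc : r c ∈ M <;> by_cases hd : r d ∈ M <;> simp [g, hc, hd] at hcd
    · rw [← hr c, ← hr d, hcd]
    · rw [← hr c, ← hr d]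
      refine twin _ _ hc hd ((hmr (r c)).trans ?_) hcd.2
      rw [hcd.1]
      exact (hmr (r d)).symm
  have hle := Nat.card_le_card_of_injective g ginj
  simp at hle
  omega
end

section
/- Suppose a graph G contains no connected component that is an isolated vertex or a complete bipartite graph, and G can be transformed into a bicluster graph H by a sequence of k operations (edge additions, edge deletions, vertex splits). Then H has at most 2k connected components. -/
theorem pair_ncard_le {α : Type} (a b : α) : ({a, b} : Set α).ncard ≤ 2 := by
  refine (Set.ncard_insert_le a {b}).trans ?_
  simp

/-- Every complete bipartite component of `G` contains a marked vertex. -/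
def MarkedOK {V : Type} (G : SimpleGraph V) (M : Set V) : Prop :=
  ∀ x, IsCompleteBipartiteOn G {y | G.Reachable x y} → ∃ m ∈ M, G.Reachable x m

theorem markedOK_transfer {V W : Type} (G : SimpleGraph V) (G' : SimpleGraph W)
    (f : W → V) (T : Set W) (M : Set V) (M' : Set W)
    (hT : T ⊆ M') (hM : ∀ y, f y ∈ M → y ∈ M')
    (hinj : ∀ x y, x ∉ T → y ∉ T → f x = f y → x = y)
    (hadj : ∀ x y, x ∉ T → y ∉ T → (G'.Adj x y ↔ G.Adj (f x) (f y)))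
    (hlift : ∀ x b, x ∉ T → G.Adj (f x) b → ∃ y, G'.Adj x y ∧ f y = b)
    (h : MarkedOK G M) : MarkedOK G' M' := by
  intro x hx
  by_contra hno
  push Not at hno
  have hnT : ∀ y, G'.Reachable x y → y ∉ T := fun y hy hyT => hno y (hT hyT) hy
  have hfw : ∀ y, G'.Reachable x y → G.Reachable (f x) (f y) := by
    intro y hy
    have hy' := (SimpleGraph.reachable_iff_reflTransGen x y).1 hy
    induction hy' with
    | refl => exact SimpleGraph.Reachable.refl _
    | tail h1 h2 ih =>
      have r1 := (SimpleGraph.reachable_iff_reflTransGen _ _).2 h1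
      exact (ih r1).trans ((hadj _ _ (hnT _ r1) (hnT _ hy)).1 h2).reachable
  have hbw : ∀ b, G.Reachable (f x) b → ∃ y, G'.Reachable x y ∧ f y = b := by
    intro b hb
    have hb' := (SimpleGraph.reachable_iff_reflTransGen _ _).1 hb
    clear hb
    induction hb' with
    | refl => exact ⟨x, SimpleGraph.Reachable.refl _, rfl⟩
    | tail h1 h2 ih =>
      obtain ⟨y, hy, rfl⟩ := ih
      obtain ⟨z, hz, rfl⟩ := hlift y _ (hnT y hy) h2
      exact ⟨z, hy.trans hz.reachable, rfl⟩
  have hI : ∀ y z, G'.Reachable x y → G'.Reachable x z → f y = f z → y = z :=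
    fun y z hy hz => hinj y z (hnT y hy) (hnT z hz)
  obtain ⟨A, B, hAB, hd, hadj2⟩ := hx
  have hA : ∀ a ∈ A, G'.Reachable x a := fun a ha => by
    have : a ∈ A ∪ B := Or.inl ha
    rw [hAB] at this; exact this
  have hB : ∀ a ∈ B, G'.Reachable x a := fun a ha => by
    have : a ∈ A ∪ B := Or.inr ha
    rw [hAB] at this; exact this
  have mA : ∀ y, G'.Reachable x y → (f y ∈ f '' A ↔ y ∈ A) := fun y hy =>
    ⟨fun ⟨a, ha, e⟩ => hI a y (hA a ha) hy e ▸ ha, fun h => ⟨y, h, rfl⟩⟩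
  have mB : ∀ y, G'.Reachable x y → (f y ∈ f '' B ↔ y ∈ B) := fun y hy =>
    ⟨fun ⟨a, ha, e⟩ => hI a y (hB a ha) hy e ▸ ha, fun h => ⟨y, h, rfl⟩⟩
  have key : IsCompleteBipartiteOn G {y | G.Reachable (f x) y} := by
    refine ⟨f '' A, f '' B, ?_, ?_, ?_⟩
    · rw [← Set.image_union, hAB]
      ext b
      constructor
      · rintro ⟨y, hy, rfl⟩
        exact hfw y hy
      · intro hb
        exact hbw b hb
    · rw [Set.disjoint_left]
      rintro _ ⟨a, ha, rfl⟩ hb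
      exact Set.disjoint_left.1 hd ha ((mB a (hA a ha)).1 hb)
    · intro p hp q hq
      obtain ⟨p, hp', rfl⟩ := hbw p hp
      obtain ⟨q, hq', rfl⟩ := hbw q hq
      rw [← hadj p q (hnT p hp') (hnT q hq'), mA p hp', mB p hp', mA q hq', mB q hq']
      exact hadj2 p hp' q hq'
  obtain ⟨m, hm, hr⟩ := h (f x) key
  obtain ⟨y, hy, rfl⟩ := hbw m hr
  exact hno y (hM y hm) hy

theorem markedOK_step {V W : Type} {G : SimpleGraph V} {H : SimpleGraph W}
    (hs : EditStep G H) (M : Set V) (hfin : M.Finite) (h : MarkedOK G M) :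
    ∃ M' : Set W, M'.Finite ∧ M'.ncard ≤ M.ncard + 2 ∧ MarkedOK H M' := by
  cases hs with
  | add u v huv =>
    refine ⟨M ∪ {u, v}, hfin.union (by simp), ?_, ?_⟩
    · exact (Set.ncard_union_le _ _).trans (by gcongr; exact pair_ncard_le _ _)
    · refine markedOK_transfer G _ id {u, v} M _ Set.subset_union_right
        (fun y hy => Or.inl hy) (fun _ _ _ _ e => e) ?_ ?_ h
      · intro x y hx hy
        simp at hx hy ⊢
        grind
      · intro x b hx hb
        exact ⟨b, Or.inl hb, rfl⟩
  | del u v =>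
    refine ⟨M ∪ {u, v}, hfin.union (by simp), ?_, ?_⟩
    · exact (Set.ncard_union_le _ _).trans (by gcongr; exact pair_ncard_le _ _)
    · refine markedOK_transfer G _ id {u, v} M _ Set.subset_union_right
        (fun y hy => Or.inl hy) (fun _ _ _ _ e => e) ?_ ?_ h
      · intro x y hx hy
        simp at hx hy ⊢
        grind
      · intro x b hx hb
        refine ⟨b, ?_, rfl⟩
        simp at hx hb ⊢
        grind
  | split v N1 N2 hN =>
    refine ⟨Sum.inl '' M ∪ {Sum.inl v, Sum.inr ()}, (hfin.image _).union (by simp), ?_, ?_⟩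
    · refine (Set.ncard_union_le _ _).trans ?_
      gcongr
      · exact Set.ncard_image_le hfin
      · exact pair_ncard_le _ _
    · have hN' : ∀ b, G.Adj v b ↔ b ∈ N1 ∨ b ∈ N2 := fun b => by
        rw [← SimpleGraph.mem_neighborSet, ← hN]; rfl
      refine markedOK_transfer G _ (Sum.elim id (fun _ => v)) {Sum.inl v, Sum.inr ()} M _
        Set.subset_union_right ?_ ?_ ?_ ?_ h
      · rintro (y | y) hy
        · exact Or.inl ⟨y, hy, rfl⟩
        · exact Or.inr (Or.inr rfl)
      · rintro (x | x) (y | y) hx hy <;> simp at hx hy ⊢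
      · rintro (x | x) (y | y) hx hy <;> simp [splitGraph] at hx hy ⊢
        have := G.adj_comm x y
        have := @SimpleGraph.Adj.ne _ G x y
        grind
      · rintro (x | x) b hx hb <;> simp at hx hb
        by_cases hbv : b = v
        · subst hbv
          rcases (hN' x).1 hb.symm with h1 | h2
          · exact ⟨Sum.inl b, by simp [splitGraph, h1, hx], rfl⟩
          · exact ⟨Sum.inr (), by simp [splitGraph, h2], rfl⟩
        · exact ⟨Sum.inl b, by simp [splitGraph, hx, hbv, hb, hb.ne], rfl⟩

theorem supp_mk_eq {V : Type} (G : SimpleGraph V) (x : V) :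
    (G.connectedComponentMk x).supp = {y | G.Reachable x y} := by
  ext y
  simp only [SimpleGraph.ConnectedComponent.mem_supp_iff, SimpleGraph.ConnectedComponent.eq,
    Set.mem_ofPred_eq]
  exact SimpleGraph.reachable_comm

theorem card_le_of_seq {V W : Type} {G : SimpleGraph V} {H : SimpleGraph W} {k : ℕ}
    (hseq : EditSeq k G H) (hH : IsBicluster H) :
    ∀ M : Set V, M.Finite → MarkedOK G M →
      Nat.card H.ConnectedComponent ≤ M.ncard + 2 * k := by
  induction hseq with
  | nil G =>
    intro M hfin hM
    have : Finite M := hfin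
    have hsurj : Function.Surjective (fun m : M => G.connectedComponentMk m.1) := by
      intro c
      induction c using SimpleGraph.ConnectedComponent.ind with
      | h x =>
        have hx := hH (G.connectedComponentMk x)
        rw [supp_mk_eq] at hx
        obtain ⟨m, hm, hr⟩ := hM x hx
        exact ⟨⟨m, hm⟩, SimpleGraph.ConnectedComponent.eq.2 hr.symm⟩
    have := Nat.card_le_card_of_surjective _ hsurj
    rw [Nat.card_coe_set_eq] at this
    omega
  | cons hs _ ih =>
    intro M hfin hM
    obtain ⟨M', hf', hc, hM'⟩ := markedOK_step hs M hfin hM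
    have := ih hH M' hf' hM'
    omega

/-- If no connected component of `G` is an isolated vertex or a complete bipartite
graph, and `G` is transformed into a bicluster graph `H` by a sequence of `k` edit
operations, then `H` has at most `2k` connected components. -/
theorem stmt_13 {V W : Type} (G : SimpleGraph V) (H : SimpleGraph W) (k : ℕ)
    (hcomp : ∀ c : G.ConnectedComponent,
      ¬ ((∃ x, c.supp = {x}) ∨ IsCompleteBipartiteOn G c.supp))
    (hseq : EditSeq k G H) (hH : IsBicluster H) :
    Nat.card H.ConnectedComponent ≤ 2 * k := by
  have := card_le_of_seq hseq hH ∅ Set.finite_empty (fun x hx => by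
    rw [← supp_mk_eq] at hx
    exact absurd (Or.inr hx) (hcomp _))
  simpa using this
end
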